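/- The regular tetrahedron does not tile space: if T ⊆ ℝ³ is the convex hull of four points that are pairwise at the same positive distance from each other, then there is no locally finite monohedral tiling of ℝ³ with prototile T (contrary to Aristotle's claim). -/

import Mathlib

open Set

noncomputable section

abbrev Euc (d : ℕ) := EuclideanSpace ℝ (Fin d)

/-- A tiling of `ℝ^d`: a family of closed sets covering the space with pairwise
disjoint interiors. -/
def IsTiling {d : ℕ} (𝒯 : Set (Set (Euc d))) : Prop :=
  (∀ T ∈ 𝒯, IsClosed T) ∧ ⋃₀ 𝒯 = Set.univ ∧
    𝒯.Pairwise fun S T => interior S ∩ interior T = ∅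

/-- Local finiteness: every compact set meets only finitely many tiles. -/
def LocallyFiniteTiling {d : ℕ} (𝒯 : Set (Set (Euc d))) : Prop :=
  ∀ K : Set (Euc d), IsCompact K → {T ∈ 𝒯 | (T ∩ K).Nonempty}.Finite

/-- `S` is an isometric copy of `T`. -/
def IsometricCopy {d : ℕ} (S T : Set (Euc d)) : Prop :=
  ∃ g : Euc d ≃ᵢ Euc d, g '' T = S

/-- A monohedral tiling with prototile `T`. -/
def Monohedral {d : ℕ} (𝒯 : Set (Set (Euc d))) (T : Set (Euc d)) : Prop :=
  ∀ S ∈ 𝒯, IsometricCopy S T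

/-- A convex `d`-polytope in `ℝ^d`: convex hull of a finite set, with nonempty interior. -/
def IsConvexPolytope {d : ℕ} (P : Set (Euc d)) : Prop :=
  (∃ V : Finset (Euc d), P = convexHull ℝ (V : Set (Euc d))) ∧ (interior P).Nonempty

/-- A tiling is face-to-face if the intersection of any two distinct tiles is a
face (extreme subset), possibly empty, of each of them. -/
def FaceToFace {d : ℕ} (𝒯 : Set (Set (Euc d))) : Prop :=
  ∀ S ∈ 𝒯, ∀ T ∈ 𝒯, S ≠ T → IsExtreme ℝ S (S ∩ T) ∧ IsExtreme ℝ T (S ∩ T)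

/-- Combinatorial equivalence: an order isomorphism between the face posets
(posets of extreme subsets ordered by inclusion). -/
def CombEquiv {d e : ℕ} (P : Set (Euc d)) (Q : Set (Euc e)) : Prop :=
  Nonempty ({F : Set (Euc d) // IsExtreme ℝ P F} ≃o {F : Set (Euc e) // IsExtreme ℝ Q F})

/-- A facet: a maximal proper nonempty face. -/
def IsFacet {d : ℕ} (Q F : Set (Euc d)) : Prop :=
  IsExtreme ℝ Q F ∧ F.Nonempty ∧ F ≠ Q ∧
    ∀ G : Set (Euc d), IsExtreme ℝ Q G → G ≠ Q → F ⊆ G → G = F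

/-- The vector from the centroid of `w` to its `i`-th vertex. -/
def spoke (w : Fin 4 → Euc 3) (i : Fin 4) : Euc 3 :=
  w i - (1 / 4 : ℝ) • ∑ j, w j

/-- For a regular tetrahedron of edge length `r`, this is `r ^ 2 / 2` times the `i`-th barycentric
coordinate. -/
def spokeCoord (r : ℝ) (w : Fin 4 → Euc 3) (i : Fin 4) (x : Euc 3) : ℝ :=
  r ^ 2 / 8 + inner ℝ (spoke w i) (x - (1 / 4 : ℝ) • ∑ j, w j)

lemma sum_spoke (w : Fin 4 → Euc 3) : ∑ i, spoke w i = 0 := by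
  simp only [spoke, Finset.sum_sub_distrib, Finset.sum_const, Finset.card_univ, Fintype.card_fin]
  module

lemma spokeCoord_add_smul (r : ℝ) (w : Fin 4 → Euc 3) (i : Fin 4) (x c : Euc 3) (s : ℝ) :
    spokeCoord r w i (x + s • c) = spokeCoord r w i x + s * inner ℝ (spoke w i) c := by
  simp only [spokeCoord, add_sub_right_comm, inner_add_right, inner_smul_right]
  ring

lemma continuous_spokeCoord (r : ℝ) (w : Fin 4 → Euc 3) (i : Fin 4) :
    Continuous (spokeCoord r w i) := by
  unfold spokeCoord
  fun_prop

section RegularTetrahedron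

variable {w : Fin 4 → Euc 3} {r : ℝ}

lemma inner_spoke_spoke (hw : ∀ i j, i ≠ j → dist (w i) (w j) = r) (i j : Fin 4) :
    inner ℝ (spoke w i) (spoke w j) = if i = j then 3 * r ^ 2 / 8 else -(r ^ 2 / 8) := by
  have key : ∀ i j, i ≠ j →
      ‖w i‖ ^ 2 - 2 * inner ℝ (w i) (w j) + ‖w j‖ ^ 2 = r ^ 2 := by
    intro i j hij
    rw [← hw i j hij, dist_eq_norm, norm_sub_sq_real]
  have h01 := key 0 1 (by decide)
  have h02 := key 0 2 (by decide)
  have h03 := key 0 3 (by decide)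
  have h12 := key 1 2 (by decide)
  have h13 := key 1 3 (by decide)
  have h23 := key 2 3 (by decide)
  have c01 := real_inner_comm (w 0) (w 1)
  have c02 := real_inner_comm (w 0) (w 2)
  have c03 := real_inner_comm (w 0) (w 3)
  have c12 := real_inner_comm (w 1) (w 2)
  have c13 := real_inner_comm (w 1) (w 3)
  have c23 := real_inner_comm (w 2) (w 3)
  simp only [spoke, Fin.sum_univ_four, inner_sub_left, inner_sub_right, inner_add_left,
    inner_add_right, inner_smul_left, inner_smul_right, RCLike.conj_to_real]
  fin_cases i <;> fin_cases j <;> simp <;> linarith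

lemma eq_zero_of_inner_spoke_eq_zero (hr : 0 < r) (hw : ∀ i j, i ≠ j → dist (w i) (w j) = r)
    {z : Euc 3} (hz : ∀ i, inner ℝ (spoke w i) z = 0) : z = 0 := by
  have hr2 : 0 < r ^ 2 := by positivity
  have hli : LinearIndependent ℝ (fun i : Fin 3 => spoke w i.castSucc) := by
    rw [Fintype.linearIndependent_iff]
    intro g hg
    have h : ∀ j : Fin 4, ∑ i : Fin 3, g i * inner ℝ (spoke w j) (spoke w i.castSucc) = 0 := by
      intro j
      have := congrArg (fun y => inner ℝ (spoke w j) y) hg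
      simpa [inner_sum, inner_smul_right] using this
    have h0 := h 0
    have h1 := h 1
    have h2 := h 2
    simp [inner_spoke_spoke hw, Fin.sum_univ_three] at h0 h1 h2
    have hs : ∀ x : ℝ, x * r ^ 2 = 0 → x = 0 := fun x hx =>
      (mul_eq_zero.mp hx).resolve_right hr2.ne'
    intro i
    apply hs
    fin_cases i
    · change g 0 * r ^ 2 = 0
      linarith
    · change g 1 * r ^ 2 = 0
      linarith
    · change g 2 * r ^ 2 = 0
      linarith
  have htop := hli.span_eq_top_of_card_eq_finrank (by simp)
  have hmem : z ∈ (Submodule.span ℝ (Set.range fun i : Fin 3 => spoke w i.castSucc))ᗮ := by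
    rw [Submodule.mem_orthogonal]
    intro u hu
    induction hu using Submodule.span_induction with
    | mem x hx => obtain ⟨i, rfl⟩ := hx; exact hz _
    | zero => simp
    | add x y _ _ hx hy => simp [inner_add_left, hx, hy]
    | smul a x _ hx => simp [inner_smul_left, hx]
  rw [htop, Submodule.top_orthogonal_eq_bot] at hmem
  simpa using hmem

lemma spokeCoord_vertex (hw : ∀ i j, i ≠ j → dist (w i) (w j) = r) (i j : Fin 4) :
    spokeCoord r w i (w j) = if i = j then r ^ 2 / 2 else 0 := by
  rw [spokeCoord, ← spoke, inner_spoke_spoke hw]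
  split_ifs <;> ring

lemma sum_spokeCoord (x : Euc 3) : ∑ i, spokeCoord r w i x = r ^ 2 / 2 := by
  simp only [spokeCoord, Finset.sum_add_distrib, ← sum_inner, sum_spoke]
  simp
  ring

lemma sum_spokeCoord_smul (hr : 0 < r) (hw : ∀ i j, i ≠ j → dist (w i) (w j) = r) (x : Euc 3) :
    ∑ i, (2 / r ^ 2 * spokeCoord r w i x) • w i = x := by
  set G : Euc 3 := (1 / 4 : ℝ) • ∑ j, w j with hG
  have hsum : ∑ i, 2 / r ^ 2 * spokeCoord r w i x = 1 := by
    rw [← Finset.mul_sum, sum_spokeCoord]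
    field_simp
  have hwi : ∀ i, w i = spoke w i + G := fun i => by simp [spoke, hG]
  have hz : x - G - ∑ i, (2 / r ^ 2 * spokeCoord r w i x) • spoke w i = 0 := by
    apply eq_zero_of_inner_spoke_eq_zero hr hw
    intro j
    have h0 : ∑ i, inner ℝ (spoke w i) (x - G) = 0 := by
      rw [← sum_inner, sum_spoke, inner_zero_left]
    rw [inner_sub_right, inner_sum]
    simp only [inner_smul_right, inner_spoke_spoke hw, spokeCoord, ← hG]
    simp only [Fin.sum_univ_four] at h0 ⊢
    fin_cases j <;> simp <;> field_simp <;> linarith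
  have : ∑ i, (2 / r ^ 2 * spokeCoord r w i x) • w i =
      ∑ i, (2 / r ^ 2 * spokeCoord r w i x) • spoke w i + G := by
    conv_lhs => enter [2, i]; rw [hwi i, smul_add]
    rw [Finset.sum_add_distrib, ← Finset.sum_smul, hsum, one_smul]
  rw [this, ← sub_eq_zero, ← neg_eq_zero, ← hz]
  abel

lemma convexHull_eq_spokeCoord_nonneg (hr : 0 < r)
    (hw : ∀ i j, i ≠ j → dist (w i) (w j) = r) :
    convexHull ℝ (Set.range w) = {x | ∀ i, 0 ≤ spokeCoord r w i x} := by
  apply Set.Subset.antisymm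
  · apply convexHull_min
    · rintro _ ⟨j, rfl⟩ i
      rw [spokeCoord_vertex hw]
      split_ifs <;> positivity
    · intro x hx y hy a b ha hb hab i
      have : spokeCoord r w i (a • x + b • y) =
          a * spokeCoord r w i x + b * spokeCoord r w i y := by
        obtain rfl : b = 1 - a := by linarith
        simp only [spokeCoord, inner_sub_right, inner_add_right, inner_smul_right]
        ring
      rw [this]
      have := hx i
      have := hy i
      positivity
  · intro x hx
    rw [← sum_spokeCoord_smul hr hw x]
    apply (convex_convexHull ℝ (Set.range w)).sum_mem
    · intro i _
      have := hx i
      positivity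
    · rw [← Finset.mul_sum, sum_spokeCoord]
      field_simp
    · exact fun i _ => subset_convexHull ℝ _ ⟨i, rfl⟩

lemma mem_interior_of_spokeCoord_pos {x : Euc 3} (hx : ∀ i, 0 < spokeCoord r w i x) :
    x ∈ interior {x | ∀ i, 0 ≤ spokeCoord r w i x} := by
  refine mem_interior.mpr ⟨{x | ∀ i, 0 < spokeCoord r w i x}, fun y hy i => (hy i).le, ?_, hx⟩
  simp only [Set.ofPred_forall]
  exact isOpen_iInter_of_finite fun i =>
    isOpen_lt continuous_const (continuous_spokeCoord r w i)

end RegularTetrahedron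

lemma IsometryEquiv.image_convexHull_range {ι : Type*} (g : Euc 3 ≃ᵢ Euc 3) (v : ι → Euc 3) :
    g '' convexHull ℝ (Set.range v) = convexHull ℝ (Set.range (g ∘ v)) := by
  rw [Set.range_comp]
  exact AffineMap.image_convexHull g.toRealAffineIsometryEquiv.toAffineEquiv.toAffineMap _

/-- Arc length on the circle of directions, parametrized by `(0, 2π]`. -/
def arcMeasure : MeasureTheory.Measure ℝ := MeasureTheory.volume.restrict (Set.Ioc 0 (2 * Real.pi))

instance : MeasureTheory.IsFiniteMeasure arcMeasure := by
  unfold arcMeasure; infer_instance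

lemma arcMeasure_real_univ : arcMeasure.real Set.univ = 2 * Real.pi := by
  simp [arcMeasure, Real.pi_nonneg]

lemma arcMeasure_real_eq_of_periodic {C : Set ℝ} (hC : MeasurableSet C)
    (hp : ∀ t, t + 2 * Real.pi ∈ C ↔ t ∈ C) (a : ℝ) :
    arcMeasure.real C = MeasureTheory.volume.real (C ∩ Set.Ioc a (a + 2 * Real.pi)) := by
  have hper : Function.Periodic (C.indicator (1 : ℝ → ℝ)) (2 * Real.pi) := by
    intro t
    by_cases h : t ∈ C <;> simp [h, hp]
  have h := hper.intervalIntegral_add_eq 0 a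
  have e : ∀ b : ℝ, ∫ t in b..b + 2 * Real.pi, C.indicator (1 : ℝ → ℝ) t =
      MeasureTheory.volume.real (C ∩ Set.Ioc b (b + 2 * Real.pi)) := by
    intro b
    rw [intervalIntegral.integral_of_le (by linarith [Real.pi_pos]),
      MeasureTheory.integral_indicator_one hC, MeasureTheory.measureReal_restrict_apply hC]
  rw [e, e, zero_add] at h
  rw [← h, arcMeasure, MeasureTheory.measureReal_restrict_apply hC]

/-- The intersection of two closed half-circles whose axes form the angle `δ` has length at most
`π - δ`, and the intersection of the open half-circles has length at least `π - δ`. -/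
lemma arcMeasure_inter_halfCircles {α δ : ℝ} (h0 : 0 ≤ δ) (hδ : δ < Real.pi) :
    arcMeasure.real {t | 0 ≤ Real.cos (t - α) ∧ 0 ≤ Real.cos (t - α - δ)} ≤ Real.pi - δ ∧
      Real.pi - δ ≤ arcMeasure.real {t | 0 < Real.cos (t - α) ∧ 0 < Real.cos (t - α - δ)} := by
  have hπ := Real.pi_pos
  have e1 : ∀ t, Real.cos (t + 2 * Real.pi - α) = Real.cos (t - α) := fun t => by
    rw [← Real.cos_add_two_pi (t - α)]; ring_nf
  have e2 : ∀ t, Real.cos (t + 2 * Real.pi - α - δ) = Real.cos (t - α - δ) := fun t => by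
    rw [← Real.cos_add_two_pi (t - α - δ)]; ring_nf
  have hc1 : Continuous fun t => Real.cos (t - α) := by fun_prop
  have hc2 : Continuous fun t => Real.cos (t - α - δ) := by fun_prop
  constructor
  · have hmeas : MeasurableSet {t | 0 ≤ Real.cos (t - α) ∧ 0 ≤ Real.cos (t - α - δ)} :=
      ((isClosed_le continuous_const hc1).inter (isClosed_le continuous_const hc2)).measurableSet
    rw [arcMeasure_real_eq_of_periodic hmeas (by simp [e1, e2]) (α - Real.pi)]
    calc _ ≤ MeasureTheory.volume.real
          (Set.Icc (α + δ - Real.pi / 2) (α + Real.pi / 2)) := by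
          apply MeasureTheory.measureReal_mono _ (by simp)
          rintro t ⟨⟨h1, h2⟩, h3, h4⟩
          have hle : t ≤ α + Real.pi / 2 := by
            by_contra! h
            have := Real.cos_neg_of_pi_div_two_lt_of_lt (x := t - α) (by linarith) (by linarith)
            linarith
          refine ⟨?_, hle⟩
          by_contra! h
          rw [← Real.cos_neg] at h1 h2
          by_cases hs : -(t - α) ≤ Real.pi / 2
          · have := Real.cos_neg_of_pi_div_two_lt_of_lt (x := -(t - α - δ))
              (by linarith) (by linarith)
            linarith
          · have := Real.cos_neg_of_pi_div_two_lt_of_lt (x := -(t - α))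
              (by linarith) (by linarith)
            linarith
      _ = Real.pi - δ := by
          rw [Real.volume_real_Icc_of_le (by linarith)]; ring
  · have hmeas : MeasurableSet {t | 0 < Real.cos (t - α) ∧ 0 < Real.cos (t - α - δ)} :=
      ((isOpen_lt continuous_const hc1).inter (isOpen_lt continuous_const hc2)).measurableSet
    rw [arcMeasure_real_eq_of_periodic hmeas (by simp [e1, e2]) (α - Real.pi)]
    calc Real.pi - δ = MeasureTheory.volume.real
          (Set.Ioo (α + δ - Real.pi / 2) (α + Real.pi / 2)) := by
          rw [Real.volume_real_Ioo_of_le (by linarith)]; ring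
      _ ≤ _ := by
          apply MeasureTheory.measureReal_mono _
            (MeasureTheory.measure_inter_lt_top_of_right_ne_top measure_Ioc_lt_top.ne).ne
          rintro t ⟨h1, h2⟩
          exact ⟨⟨Real.cos_pos_of_mem_Ioo ⟨by linarith, by linarith⟩,
            Real.cos_pos_of_mem_Ioo ⟨by linarith, by linarith⟩⟩, by linarith, by linarith⟩

lemma exists_polar {A B ρ : ℝ} (hρ : 0 < ρ) (h : A ^ 2 + B ^ 2 = ρ ^ 2) :
    ∃ α, A = ρ * Real.cos α ∧ B = ρ * Real.sin α := by
  have hn : ‖(⟨A, B⟩ : ℂ)‖ = ρ := by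
    rw [Complex.norm_eq_sqrt_sq_add_sq, h, Real.sqrt_sq hρ.le]
  refine ⟨Complex.arg ⟨A, B⟩, ?_, ?_⟩
  · rw [← hn, Complex.norm_mul_cos_arg]
  · rw [← hn, Complex.norm_mul_sin_arg]

lemma arcMeasure_wedge {A B A' B' ρ k : ℝ} (hρ : 0 < ρ) (hk : -1 < k) (hk' : k ≤ 1)
    (h : A ^ 2 + B ^ 2 = ρ ^ 2)
    (h' : A' ^ 2 + B' ^ 2 = ρ ^ 2) (hAB : A * A' + B * B' = k * ρ ^ 2) :
    arcMeasure.real {t | 0 ≤ A * Real.cos t + B * Real.sin t ∧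
        0 ≤ A' * Real.cos t + B' * Real.sin t} ≤ Real.pi - Real.arccos k ∧
      Real.pi - Real.arccos k ≤ arcMeasure.real {t | 0 < A * Real.cos t + B * Real.sin t ∧
        0 < A' * Real.cos t + B' * Real.sin t} := by
  obtain ⟨α, rfl, rfl⟩ := exists_polar hρ h
  obtain ⟨β, rfl, rfl⟩ := exists_polar hρ h'
  have hcos : Real.cos (β - α) = k := by
    rw [Real.cos_sub]
    have : ρ ^ 2 ≠ 0 := by positivity
    apply mul_right_cancel₀ this
    linarith
  have hf : ∀ α t, ρ * Real.cos α * Real.cos t + ρ * Real.sin α * Real.sin t =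
      ρ * Real.cos (t - α) := fun α t => by rw [Real.cos_sub]; ring
  simp only [hf, mul_nonneg_iff_of_pos_left hρ, mul_pos_iff_of_pos_left hρ]
  clear h h' hAB
  wlog hs : 0 ≤ Real.sin (β - α) generalizing α β
  · have := this β α (by rw [← hcos, ← Real.cos_neg]; ring_nf)
      (by rw [← neg_sub, Real.sin_neg]; linarith)
    simpa only [and_comm] using this
  have hsin : Real.sin (β - α) = Real.sin (Real.arccos k) := by
    rw [Real.sin_arccos, ← hcos, ← Real.abs_sin_eq_sqrt_one_sub_cos_sq, abs_of_nonneg hs]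
  have hβ : ∀ t, Real.cos (t - β) = Real.cos (t - α - Real.arccos k) := fun t => by
    rw [show t - β = t - α - (β - α) by ring, Real.cos_sub, Real.cos_sub (t - α), hsin, hcos,
      Real.cos_arccos hk.le hk']
  simp only [hβ]
  exact arcMeasure_inter_halfCircles (Real.arccos_nonneg _) ((Real.arccos_le_pi _).lt_of_ne
    (mt Real.arccos_eq_pi.1 hk.not_ge))

lemma arccos_one_third_bounds :
    Real.pi < 3 * Real.arccos (1 / 3) ∧ 5 * Real.arccos (1 / 3) < 2 * Real.pi := by
  have hπ := Real.pi_pos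
  constructor
  · have : Real.arccos (1 / 2) < Real.arccos (1 / 3) :=
      Real.strictAntiOn_arccos (by norm_num) (by norm_num) (by norm_num)
    rw [show (1 / 2 : ℝ) = Real.cos (Real.pi / 3) by simp,
      Real.arccos_cos (by linarith) (by linarith)] at this
    linarith
  · have hlt : Real.cos (2 * (Real.pi / 5)) < 1 / 3 := by
      rw [Real.cos_two_mul, Real.cos_pi_div_five]
      have h5 := Real.sq_sqrt (show (0 : ℝ) ≤ 5 by norm_num)
      have : √5 < 7 / 3 := by
        rw [Real.sqrt_lt' (by norm_num)]; norm_num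
      nlinarith
    have := Real.strictAntiOn_arccos (Real.cos_mem_Icc _) (by norm_num) hlt
    rw [Real.arccos_cos (by linarith) (by linarith)] at this
    linarith

/-- The angles `arccos (1/3)`, `π` and `2π`, the first occurring at least once, never add up to
`2π`. -/
lemma sum_angles_ne_two_pi {ι : Type*} {s : Finset ι} {m : ι → ℝ} {i₀ : ι} (hi₀ : i₀ ∈ s)
    (hm₀ : m i₀ = Real.arccos (1 / 3))
    (hm : ∀ i ∈ s, m i = 2 * Real.pi ∨ m i = Real.pi ∨ m i = Real.arccos (1 / 3)) :
    ∑ i ∈ s, m i ≠ 2 * Real.pi := by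
  classical
  intro hsum
  obtain ⟨hθ, hθ'⟩ := arccos_one_third_bounds
  set θ := Real.arccos (1 / 3)
  have hπ := Real.pi_pos
  have key : ∀ u : Finset ι, u ⊆ s → ∃ a b : ℕ, ∑ i ∈ u, m i = a * θ + b * Real.pi := by
    intro u
    induction u using Finset.induction_on with
    | empty => exact fun _ => ⟨0, 0, by simp⟩
    | insert i u hi ih =>
      intro hu
      obtain ⟨a, b, hab⟩ := ih fun x hx => hu (Finset.mem_insert_of_mem hx)
      rw [Finset.sum_insert hi, hab]
      rcases hm i (hu (Finset.mem_insert_self _ _)) with h | h | h <;> rw [h]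
      · exact ⟨a, b + 2, by push_cast; ring⟩
      · exact ⟨a, b + 1, by push_cast; ring⟩
      · exact ⟨a + 1, b, by push_cast; ring⟩
  obtain ⟨a, b, hab⟩ := key (s.erase i₀) (Finset.erase_subset _ _)
  rw [← Finset.add_sum_erase s m hi₀, hm₀, hab] at hsum
  have hb : b < 2 := by
    by_contra! h
    have : (2 : ℝ) ≤ b := by exact_mod_cast h
    nlinarith [mul_nonneg a.cast_nonneg (show (0 : ℝ) ≤ θ by linarith)]
  have ha : a < 5 := by
    by_contra! h
    have : (5 : ℝ) ≤ a := by exact_mod_cast h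
    nlinarith [mul_nonneg b.cast_nonneg hπ.le]
  interval_cases b <;> interval_cases a <;> norm_num at hsum <;> linarith

section TangentArc

variable {w : Fin 4 → Euc 3} {r : ℝ}

/-- The unit vectors orthogonal to the first vector of a basis. -/
def circleDir (b : OrthonormalBasis (Fin 3) ℝ (Euc 3)) (t : ℝ) : Euc 3 :=
  Real.cos t • b 1 + Real.sin t • b 2

/-- The directions orthogonal to `b 0` that point from `p` weakly into the tetrahedron. -/
def closedTangentArc (r : ℝ) (w : Fin 4 → Euc 3) (b : OrthonormalBasis (Fin 3) ℝ (Euc 3))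
    (p : Euc 3) : Set ℝ :=
  {t | ∀ i, spokeCoord r w i p = 0 → 0 ≤ inner ℝ (spoke w i) (circleDir b t)}

/-- The directions orthogonal to `b 0` that point from `p` strictly into the tetrahedron. -/
def openTangentArc (r : ℝ) (w : Fin 4 → Euc 3) (b : OrthonormalBasis (Fin 3) ℝ (Euc 3))
    (p : Euc 3) : Set ℝ :=
  {t | ∀ i, spokeCoord r w i p = 0 → 0 < inner ℝ (spoke w i) (circleDir b t)}

lemma measurableSet_openTangentArc (b : OrthonormalBasis (Fin 3) ℝ (Euc 3)) (p : Euc 3) :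
    MeasurableSet (openTangentArc r w b p) := by
  unfold openTangentArc
  simp only [Set.ofPred_forall]
  refine MeasurableSet.iInter fun i => MeasurableSet.iInter fun _ =>
    (isOpen_lt continuous_const ?_).measurableSet
  unfold circleDir
  fun_prop

lemma inner_circleDir (b : OrthonormalBasis (Fin 3) ℝ (Euc 3)) (x : Euc 3) (t : ℝ) :
    inner ℝ x (circleDir b t) =
      inner ℝ x (b 1) * Real.cos t + inner ℝ x (b 2) * Real.sin t := by
  simp only [circleDir, inner_add_right, inner_smul_right]
  ring

lemma inner_eq_of_inner_basis_zero {b : OrthonormalBasis (Fin 3) ℝ (Euc 3)} {x y : Euc 3}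
    (hx : inner ℝ x (b 0) = 0) :
    inner ℝ x (b 1) * inner ℝ y (b 1) + inner ℝ x (b 2) * inner ℝ y (b 2) = inner ℝ x y := by
  rw [← b.sum_inner_mul_inner x y, Fin.sum_univ_three, hx, real_inner_comm y (b 1),
    real_inner_comm y (b 2)]
  ring

lemma arcMeasure_spokes (hr : 0 < r) (hw : ∀ i j, i ≠ j → dist (w i) (w j) = r)
    {b : OrthonormalBasis (Fin 3) ℝ (Euc 3)} {i j : Fin 4} {k : ℝ} (hk : -1 < k) (hk' : k ≤ 1)
    (hi : inner ℝ (spoke w i) (b 0) = 0) (hj : inner ℝ (spoke w j) (b 0) = 0)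
    (hij : inner ℝ (spoke w i) (spoke w j) = k * (3 * r ^ 2 / 8)) :
    arcMeasure.real {t | 0 ≤ inner ℝ (spoke w i) (circleDir b t) ∧
        0 ≤ inner ℝ (spoke w j) (circleDir b t)} ≤ Real.pi - Real.arccos k ∧
      Real.pi - Real.arccos k ≤ arcMeasure.real
        {t | 0 < inner ℝ (spoke w i) (circleDir b t) ∧
          0 < inner ℝ (spoke w j) (circleDir b t)} := by
  have hρ : √(3 * r ^ 2 / 8) ^ 2 = 3 * r ^ 2 / 8 := Real.sq_sqrt (by positivity)
  simp only [inner_circleDir]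
  refine arcMeasure_wedge (ρ := √(3 * r ^ 2 / 8)) (by positivity) hk hk' ?_ ?_ ?_
  · rw [sq, sq, inner_eq_of_inner_basis_zero hi, inner_spoke_spoke hw, hρ, if_pos rfl]
  · rw [sq, sq, inner_eq_of_inner_basis_zero hj, inner_spoke_spoke hw, hρ, if_pos rfl]
  · rw [inner_eq_of_inner_basis_zero hi, hij, hρ]

lemma arcMeasure_tangentArc_edge (hr : 0 < r) (hw : ∀ i j, i ≠ j → dist (w i) (w j) = r)
    {b : OrthonormalBasis (Fin 3) ℝ (Euc 3)} {p : Euc 3}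
    (hp : ∀ i, spokeCoord r w i p = 0 → inner ℝ (spoke w i) (b 0) = 0) {i j : Fin 4}
    (hij : i ≠ j) (hZ : ∀ k, spokeCoord r w k p = 0 ↔ k = i ∨ k = j) :
    arcMeasure.real (closedTangentArc r w b p) ≤ Real.arccos (1 / 3) ∧
      Real.arccos (1 / 3) ≤ arcMeasure.real (openTangentArc r w b p) := by
  have := arcMeasure_spokes (k := -(1 / 3)) hr hw (by norm_num) (by norm_num)
    (hp i ((hZ i).2 (.inl rfl))) (hp j ((hZ j).2 (.inr rfl)))
    (by rw [inner_spoke_spoke hw, if_neg hij]; ring)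
  rw [Real.arccos_neg, sub_sub_cancel] at this
  simpa [closedTangentArc, openTangentArc, hZ] using this

lemma exists_arcMeasure_tangentArc (hr : 0 < r) (hw : ∀ i j, i ≠ j → dist (w i) (w j) = r)
    {b : OrthonormalBasis (Fin 3) ℝ (Euc 3)} {p : Euc 3}
    (hp : ∀ i, spokeCoord r w i p = 0 → inner ℝ (spoke w i) (b 0) = 0) :
    ∃ m, (m = 2 * Real.pi ∨ m = Real.pi ∨ m = Real.arccos (1 / 3)) ∧
      arcMeasure.real (closedTangentArc r w b p) ≤ m ∧
      m ≤ arcMeasure.real (openTangentArc r w b p) := by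
  classical
  set Z : Finset (Fin 4) := {i | spokeCoord r w i p = 0} with hZ
  have hmem : ∀ i, spokeCoord r w i p = 0 ↔ i ∈ Z := by simp [hZ]
  have hlt : Z.card < 3 := by
    by_contra! h3
    have hall : ∀ j, inner ℝ (spoke w j) (b 0) = 0 := by
      intro j
      by_cases hj : j ∈ Z
      · exact hp j ((hmem j).2 hj)
      have hc : Zᶜ.card ≤ 1 := by rw [Finset.card_compl, Fintype.card_fin]; omega
      have hs : ∑ i, inner ℝ (spoke w i) (b 0) = 0 := by
        rw [← sum_inner, sum_spoke, inner_zero_left]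
      rwa [Finset.sum_eq_single j] at hs
      · intro k _ hkj
        by_cases hk : k ∈ Z
        · exact hp k ((hmem k).2 hk)
        · exact absurd (Finset.card_le_one.1 hc k (by simpa) j (by simpa)) hkj
      · simp
    exact b.orthonormal.ne_zero 0 (eq_zero_of_inner_spoke_eq_zero hr hw hall)
  interval_cases hcard : Z.card
  · rw [Finset.card_eq_zero] at hcard
    refine ⟨2 * Real.pi, .inl rfl, ?_, ?_⟩ <;>
      simp [closedTangentArc, openTangentArc, hmem, hcard, arcMeasure_real_univ]
  · obtain ⟨i, hi⟩ := Finset.card_eq_one.1 hcard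
    have hi0 := hp i ((hmem i).2 (by simp [hi]))
    refine ⟨Real.pi, .inr (.inl rfl), ?_⟩
    have := arcMeasure_spokes (k := 1) hr hw (by norm_num) le_rfl hi0 hi0
      (by rw [inner_spoke_spoke hw, if_pos rfl, one_mul])
    simpa [closedTangentArc, openTangentArc, hmem, hi] using this
  · obtain ⟨i, j, hij, hZij⟩ := Finset.card_eq_two.1 hcard
    exact ⟨_, .inr (.inr rfl),
      arcMeasure_tangentArc_edge hr hw hp hij fun k => by rw [hmem, hZij]; simp⟩

end TangentArc

section LocalStructure

variable {w : Fin 4 → Euc 3} {r : ℝ}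

open Filter Topology

lemma eventually_mem_interior_of_mem_openTangentArc {b : OrthonormalBasis (Fin 3) ℝ (Euc 3)}
    {p : Euc 3} (hp : ∀ i, 0 ≤ spokeCoord r w i p) {t : ℝ} (ht : t ∈ openTangentArc r w b p) :
    ∀ᶠ ε in 𝓝[>] (0 : ℝ),
      p + ε • circleDir b t ∈ interior {x | ∀ i, 0 ≤ spokeCoord r w i x} := by
  have h : ∀ᶠ ε in 𝓝[>] (0 : ℝ), ∀ i, 0 < spokeCoord r w i (p + ε • circleDir b t) := by
    rw [eventually_all]
    intro i
    rcases (hp i).eq_or_lt with h0 | h0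
    · filter_upwards [self_mem_nhdsWithin] with ε hε
      rw [spokeCoord_add_smul, ← h0, zero_add]
      exact mul_pos hε (ht i h0.symm)
    · have hc : Continuous fun ε : ℝ => spokeCoord r w i (p + ε • circleDir b t) :=
        (continuous_spokeCoord r w i).comp (by fun_prop)
      exact nhdsWithin_le_nhds (hc.continuousAt.eventually_const_lt (by simpa using h0))
  filter_upwards [h] with ε hε using mem_interior_of_spokeCoord_pos hε

lemma eventually_notMem_of_notMem_closedTangentArc {b : OrthonormalBasis (Fin 3) ℝ (Euc 3)}
    {p : Euc 3} {t : ℝ} (ht : t ∉ closedTangentArc r w b p) :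
    ∀ᶠ ε in 𝓝[>] (0 : ℝ),
      p + ε • circleDir b t ∉ {x | ∀ i, 0 ≤ spokeCoord r w i x} := by
  simp only [closedTangentArc, Set.mem_ofPred_eq, not_forall, not_le] at ht
  obtain ⟨i, hi, hneg⟩ := ht
  filter_upwards [self_mem_nhdsWithin] with ε hε hmem
  have := hmem i
  rw [spokeCoord_add_smul, hi, zero_add] at this
  nlinarith [mul_neg_of_pos_of_neg (Set.mem_Ioi.1 hε) hneg]

end LocalStructure

/-- On a line through `q` with direction `d`, all but finitely many points lie on none of the face
planes of finitely many tetrahedra that do not contain the whole line. -/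
lemma exists_generic_point {ι : Type*} {F : Set ι} (hF : F.Finite) (W : ι → Fin 4 → Euc 3)
    (r : ℝ) (q d : Euc 3) :
    ∃ s ∈ Set.Ioo (0 : ℝ) 1, ∀ S ∈ F, ∀ i,
      spokeCoord r (W S) i (q + s • d) = 0 → inner ℝ (spoke (W S) i) d = 0 := by
  have hbad : (⋃ S ∈ F, ⋃ i, {s : ℝ | spokeCoord r (W S) i (q + s • d) = 0 ∧
      inner ℝ (spoke (W S) i) d ≠ 0}).Finite := by
    refine hF.biUnion fun S _ => Set.finite_iUnion fun i => Set.Subsingleton.finite ?_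
    rintro s ⟨hs, hne⟩ s' ⟨hs', -⟩
    rw [spokeCoord_add_smul] at hs hs'
    exact mul_right_cancel₀ hne (by linarith)
  obtain ⟨s, hs, hs'⟩ := (Set.Ioo_infinite (zero_lt_one (α := ℝ))).exists_notMem_finite hbad
  refine ⟨s, hs, fun S hS i h0 => ?_⟩
  by_contra hne
  exact hs' (by simp only [Set.mem_iUnion]; exact ⟨S, hS, i, h0, hne⟩)

lemma exists_orthonormalBasis_smul_eq {d : Euc 3} (hd : d ≠ 0) :
    ∃ (b : OrthonormalBasis (Fin 3) ℝ (Euc 3)) (a : ℝ), b 0 = a • d := by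
  have hon : Orthonormal ℝ (({0} : Set (Fin 3)).domRestrict fun _ => ‖d‖⁻¹ • d) := by
    constructor
    · intro i
      change ‖‖d‖⁻¹ • d‖ = 1
      simp [norm_smul, hd]
    · intro i j hij
      exact absurd (Subsingleton.elim i j) hij
  obtain ⟨b, hb⟩ := hon.exists_orthonormalBasis_extension_of_card_eq (by simp)
  exact ⟨b, _, hb 0 rfl⟩

/-- the regular tetrahedron does not tile `ℝ³`. -/
theorem regular_tetrahedron_does_not_tile (v : Fin 4 → Euc 3) (r : ℝ) (hr : 0 < r)
    (hdist : ∀ i j, i ≠ j → dist (v i) (v j) = r) :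
    ¬ ∃ 𝒯 : Set (Set (Euc 3)), IsTiling 𝒯 ∧ LocallyFiniteTiling 𝒯 ∧
        Monohedral 𝒯 (convexHull ℝ (Set.range v)) := by
  rintro ⟨𝒯, ⟨hcl, hcov, hdis⟩, hfin, hmono⟩
  have hrep : ∀ S ∈ 𝒯, ∃ w : Fin 4 → Euc 3, (∀ i j, i ≠ j → dist (w i) (w j) = r) ∧
      S = {x | ∀ i, 0 ≤ spokeCoord r w i x} := by
    intro S hS
    obtain ⟨g, rfl⟩ := hmono S hS
    have hg : ∀ i j, i ≠ j → dist ((g ∘ v) i) ((g ∘ v) j) = r := fun i j hij => by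
      simpa [g.dist_eq] using hdist i j hij
    exact ⟨g ∘ v, hg,
      (g.image_convexHull_range v).trans (convexHull_eq_spokeCoord_nonneg hr hg)⟩
  choose! W hWd hWS using hrep
  obtain ⟨S₀, hS₀, -⟩ : (0 : Euc 3) ∈ ⋃₀ 𝒯 := hcov ▸ Set.mem_univ _
  set q := W S₀ 0
  set d := W S₀ 1 - W S₀ 0
  have hdr : ‖d‖ = r := by rw [← dist_eq_norm]; exact hWd S₀ hS₀ 1 0 (by decide)
  have hd : d ≠ 0 := norm_pos_iff.1 (hdr ▸ hr)
  have hF := hfin (Metric.closedBall q (r + 1)) (isCompact_closedBall _ _)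
  set F := {T ∈ 𝒯 | (T ∩ Metric.closedBall q (r + 1)).Nonempty}
  obtain ⟨s, hs, hgen⟩ := exists_generic_point hF W r q d
  set p := q + s • d with hp
  have hpq : dist p q < r := by
    rw [hp, dist_self_add_left, norm_smul, hdr, Real.norm_of_nonneg hs.1.le]
    nlinarith [hs.2]
  have hpF : ∀ S ∈ 𝒯, p ∈ S → S ∈ F := fun S hS hpS =>
    ⟨hS, p, hpS, Metric.mem_closedBall.2 (by linarith)⟩
  obtain ⟨b, a, hb⟩ := exists_orthonormalBasis_smul_eq hd
  have hgenb : ∀ S ∈ 𝒯, p ∈ S → ∀ i, spokeCoord r (W S) i p = 0 →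
      inner ℝ (spoke (W S) i) (b 0) = 0 := fun S hS hpS i h0 => by
    rw [hb, inner_smul_right, hgen S (hpF S hS hpS) i h0, mul_zero]
  have hcoord : ∀ i, spokeCoord r (W S₀) i p =
      (1 - s) * spokeCoord r (W S₀) i (W S₀ 0) + s * spokeCoord r (W S₀) i (W S₀ 1) := fun i => by
    rw [hp, show W S₀ 1 = q + (1 : ℝ) • d by simp [q, d], spokeCoord_add_smul, spokeCoord_add_smul]
    ring
  have hr2 : 0 < r ^ 2 / 2 := by positivity
  have hpos0 : 0 < (1 - s) * (r ^ 2 / 2) := mul_pos (by linarith [hs.2]) hr2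
  have hpos1 : 0 < s * (r ^ 2 / 2) := mul_pos hs.1 hr2
  have hZ₀ : ∀ k, spokeCoord r (W S₀) k p = 0 ↔ k = 2 ∨ k = 3 := by
    intro k
    rw [hcoord, spokeCoord_vertex (hWd S₀ hS₀), spokeCoord_vertex (hWd S₀ hS₀)]
    fin_cases k <;> simp <;> constructor <;> linarith [hs.1, hs.2]
  have hpS₀ : p ∈ S₀ := by
    rw [hWS S₀ hS₀]
    intro k
    rw [hcoord, spokeCoord_vertex (hWd S₀ hS₀), spokeCoord_vertex (hWd S₀ hS₀)]
    fin_cases k <;> simp <;> linarith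
  have hIfin : {S ∈ 𝒯 | p ∈ S}.Finite := hF.subset fun S hS => hpF S hS.1 hS.2
  set I := hIfin.toFinset
  have hI : ∀ S, S ∈ I ↔ S ∈ 𝒯 ∧ p ∈ S := fun S => by simp [I]
  have hm : ∀ S ∈ I, ∃ m, (m = 2 * Real.pi ∨ m = Real.pi ∨ m = Real.arccos (1 / 3)) ∧
      (arcMeasure.real (closedTangentArc r (W S) b p) ≤ m ∧
        m ≤ arcMeasure.real (openTangentArc r (W S) b p)) ∧
      (S = S₀ → m = Real.arccos (1 / 3)) := by
    intro S hS
    obtain ⟨hST, hpS⟩ := (hI S).1 hS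
    by_cases h : S = S₀
    · subst h
      exact ⟨_, .inr (.inr rfl), arcMeasure_tangentArc_edge hr (hWd S hST) (hgenb S hST hpS)
        (by decide) hZ₀, fun _ => rfl⟩
    · obtain ⟨m, h1, h2⟩ := exists_arcMeasure_tangentArc hr (hWd S hST) (hgenb S hST hpS)
      exact ⟨m, h1, h2, fun h' => absurd h' h⟩
  choose! m hm hmarc hm₀ using hm
  have hS₀I : S₀ ∈ I := (hI S₀).2 ⟨hS₀, hpS₀⟩
  refine sum_angles_ne_two_pi hS₀I (hm₀ S₀ hS₀I rfl) hm (le_antisymm ?_ ?_)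
  · have hdisj : (I : Set (Set (Euc 3))).PairwiseDisjoint
        fun S => openTangentArc r (W S) b p := by
      intro S hS S' hS' hne
      obtain ⟨hST, hpS⟩ := (hI S).1 hS
      obtain ⟨hST', hpS'⟩ := (hI S').1 hS'
      refine Set.disjoint_left.2 fun t ht ht' => ?_
      have h1 := eventually_mem_interior_of_mem_openTangentArc (hWS S hST ▸ hpS :) ht
      have h2 := eventually_mem_interior_of_mem_openTangentArc (hWS S' hST' ▸ hpS' :) ht'
      rw [← hWS S hST] at h1
      rw [← hWS S' hST'] at h2
      obtain ⟨ε, hε⟩ := (h1.and h2).exists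
      exact (hdis hST hST' hne).subset hε
    calc ∑ S ∈ I, m S ≤ ∑ S ∈ I, arcMeasure.real (openTangentArc r (W S) b p) :=
          Finset.sum_le_sum fun S hS => (hmarc S hS).2
      _ = arcMeasure.real (⋃ S ∈ I, openTangentArc r (W S) b p) :=
          (MeasureTheory.measureReal_biUnion_finset hdisj
            fun S _ => measurableSet_openTangentArc b p).symm
      _ ≤ 2 * Real.pi := arcMeasure_real_univ ▸
          MeasureTheory.measureReal_mono (Set.subset_univ _)
  · have hcover : Set.univ ⊆ ⋃ S ∈ I, closedTangentArc r (W S) b p := by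
      intro t _
      by_contra ht
      simp only [Set.mem_iUnion, not_exists] at ht
      have hline : Continuous fun ε : ℝ => p + ε • circleDir b t := by fun_prop
      have hout : ∀ᶠ ε in nhdsWithin (0 : ℝ) (Set.Ioi 0), ∀ S ∈ F, p + ε • circleDir b t ∉ S := by
        rw [Filter.eventually_all_finite hF]
        intro S hS
        by_cases hpS : p ∈ S
        · have := eventually_notMem_of_notMem_closedTangentArc (ht S ((hI S).2 ⟨hS.1, hpS⟩))
          rwa [← hWS S hS.1] at this
        · exact nhdsWithin_le_nhds (hline.continuousAt.eventually_mem
            ((hcl S hS.1).isOpen_compl.mem_nhds (by simpa using hpS)))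
      have hnear : ∀ᶠ ε in nhdsWithin (0 : ℝ) (Set.Ioi 0),
          p + ε • circleDir b t ∈ Metric.closedBall q (r + 1) :=
        nhdsWithin_le_nhds (hline.continuousAt.eventually_mem
          (Metric.closedBall_mem_nhds_of_mem (by simp; linarith)))
      obtain ⟨ε, h1, h2⟩ := (hout.and hnear).exists
      obtain ⟨S, hS, hεS⟩ : p + ε • circleDir b t ∈ ⋃₀ 𝒯 := hcov ▸ Set.mem_univ _
      exact h1 S ⟨hS, _, hεS, h2⟩ hεS
    calc 2 * Real.pi = arcMeasure.real Set.univ := arcMeasure_real_univ.symm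
      _ ≤ arcMeasure.real (⋃ S ∈ I, closedTangentArc r (W S) b p) :=
          MeasureTheory.measureReal_mono hcover (MeasureTheory.measure_ne_top _ _)
      _ ≤ ∑ S ∈ I, arcMeasure.real (closedTangentArc r (W S) b p) :=
          MeasureTheory.measureReal_biUnion_finset_le _ _
      _ ≤ ∑ S ∈ I, m S := Finset.sum_le_sum fun S hS => (hmarc S hS).1
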